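/- Consider the market with hospitals H = {h₁,h₂}, each of capacity 2, and doctors D = {f,m,s₁,s₂}, where c = {f,m} is the unique couple and s₁,s₂ are single. Both hospitals find all doctors acceptable, with individual rankings P̄_{h₁}: f, s₁, s₂, m and P̄_{h₂}: s₂, m, f, s₁, and the hospitals' preferences over feasible sets are responsive with {f,m} P_{h₁} {s₁,s₂} (so P_{h₁} violates aversion to couple diversity). Suppose the doctors' and couple's preferences are any responsive preferences such that every doctor prefers being matched to any hospital over λ. Then the matching μ with μ(h₁) = {f,s₁} and μ(h₂) = {s₂,m} is stable. -/

import Mathlib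

/- A formal framework for many-to-one matching markets with couples
(hospitals/doctors), following the paper's definitions.  The dummy hospital
`λ` is modelled as `none : Option H`. -/

namespace CouplesMarket

open Finset

/-- A strict linear order on a subset `s` of `α`:  trichotomy on `s`,
irreflexivity, transitivity and asymmetry. -/
def StrictLinearOn {α : Type} (s : Set α) (r : α → α → Prop) : Prop :=
  (∀ a ∈ s, ∀ b ∈ s, a = b ∨ r a b ∨ r b a) ∧
  (∀ a ∈ s, ¬ r a a) ∧
  (∀ a ∈ s, ∀ b ∈ s, ∀ c ∈ s, r a b → r b c → r a c) ∧
  (∀ a ∈ s, ∀ b ∈ s, r a b → ¬ r b a)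

/-- A strict linear order on all of `α`. -/
def StrictLinear {α : Type} (r : α → α → Prop) : Prop :=
  StrictLinearOn Set.univ r

/-- The weak (reflexive) part `R` of a strict preference `P`. -/
def weakPref {α : Type} (r : α → α → Prop) (a b : α) : Prop := a = b ∨ r a b

/-- A matching market: hospitals `H` with capacities `κ`, doctors `D`, and a
set of (pairwise disjoint) couples `c = (f, m)` (first component in `F`,
second in `M`; the remaining doctors are single). -/
structure Market (D H : Type) where
  κ : H → ℕ
  couples : Finset (D × D)
  couples_ne : ∀ c ∈ couples, c.1 ≠ c.2
  couples_disjoint : ∀ c ∈ couples, ∀ c' ∈ couples, c ≠ c' →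
    c.1 ≠ c'.1 ∧ c.1 ≠ c'.2 ∧ c.2 ≠ c'.1 ∧ c.2 ≠ c'.2

/-- A doctor is single if he/she belongs to no couple. -/
def Market.Single {D H : Type} (M : Market D H) (d : D) : Prop :=
  ∀ c ∈ M.couples, d ≠ c.1 ∧ d ≠ c.2

/-- A preference profile: for each hospital `h` its set `acc h = D_h` of
acceptable doctors, its linear order `rank h = P̄_h` over individual doctors,
and its preference `hpref h = P_h` over feasible sets of doctors; for each
doctor `d` an individual (resp. marginal, for couple members) preference
`dpref d = P_d` over `H ∪ {λ}`; and for each couple `c` a preference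
`cpref c = P_c` over pairs in `(H ∪ {λ})²`. -/
structure Profile (D H : Type) where
  acc : H → Finset D
  rank : H → D → D → Prop
  hpref : H → Finset D → Finset D → Prop
  dpref : D → Option H → Option H → Prop
  cpref : D × D → Option H × Option H → Option H × Option H → Prop

variable {D H : Type} [Fintype D] [DecidableEq D] [Fintype H] [DecidableEq H]

/-- Responsiveness of hospital `h`'s preference over feasible sets of doctors:
`rank h` is a linear order on `acc h`; `hpref h` is a linear order on feasible
sets; every nonempty feasible subset of acceptable doctors is preferred to `∅`;
singleton comparisons agree with `rank h`; adding a common acceptable doctor to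
two feasible subsets of acceptable doctors preserves their comparison; and `∅`
is preferred to every feasible set not contained in `acc h`. -/
def HospResponsive (M : Market D H) (P : Profile D H) (h : H) : Prop :=
  StrictLinearOn {d | d ∈ P.acc h} (P.rank h) ∧
  StrictLinearOn {A : Finset D | A.card ≤ M.κ h} (P.hpref h) ∧
  (∀ A : Finset D, A ⊆ P.acc h → A.Nonempty → A.card ≤ M.κ h → P.hpref h A ∅) ∧
  (∀ d ∈ P.acc h, ∀ d' ∈ P.acc h, d ≠ d' → (P.hpref h {d} {d'} ↔ P.rank h d d')) ∧
  (∀ A B : Finset D, A ⊆ P.acc h → B ⊆ P.acc h → A.card < M.κ h → B.card < M.κ h →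
      ∀ d ∈ P.acc h, d ∉ A → d ∉ B →
        (P.hpref h (insert d A) (insert d B) ↔ P.hpref h A B)) ∧
  (∀ A : Finset D, A.card ≤ M.κ h → ¬ A ⊆ P.acc h → P.hpref h ∅ A)

/-- Responsiveness of a couple's preference over pairs of hospitals with
respect to the induced marginal preferences of its two members. -/
def CoupleResponsive (P : Profile D H) (c : D × D) : Prop :=
  StrictLinear (P.cpref c) ∧ StrictLinear (P.dpref c.1) ∧ StrictLinear (P.dpref c.2) ∧
  (∀ h h₁ h₂ : Option H,
    (P.cpref c (h₁, h) (h₂, h) ↔ P.dpref c.1 h₁ h₂) ∧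
    (P.cpref c (h, h₁) (h, h₂) ↔ P.dpref c.2 h₁ h₂))

/-- A fully responsive preference profile. -/
def Responsive (M : Market D H) (P : Profile D H) : Prop :=
  (∀ h : H, HospResponsive M P h) ∧
  (∀ c ∈ M.couples, CoupleResponsive P c) ∧
  (∀ d : D, M.Single d → StrictLinear (P.dpref d))

/-- A matching: each doctor is assigned a hospital in `H ∪ {λ}` (where `none`
means unemployed), respecting capacities.  (Disjointness of the hospitals'
sets of doctors is automatic, and the dummy hospital has capacity `|D|`.) -/
structure Matching {D H : Type} [Fintype D] [DecidableEq D] [DecidableEq H]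
    (M : Market D H) : Type where
  assign : D → Option H
  quota : ∀ h : H, (Finset.univ.filter fun d => assign d = some h).card ≤ M.κ h

/-- `μ(h)`, the set of doctors matched with hospital `h`. -/
def Matching.assigned {M : Market D H} (μ : Matching M) (h : H) : Finset D :=
  Finset.univ.filter fun d => μ.assign d = some h

/-- Hospital `h ∈ H ∪ {λ}` prefers the set of doctors `A` to (a subset of) its
assignment at `μ`: there is `B ⊆ μ(h)` disjoint from `A` such that the feasible
set `(μ(h) \ B) ∪ A` is preferred to `μ(h)`.  The dummy hospital always
prefers to have any doctors. -/
def HosPrefers (M : Market D H) (P : Profile D H) (μ : Matching M) :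
    Option H → Finset D → Prop
  | none, _ => True
  | some h, A => ∃ B ⊆ μ.assigned h, Disjoint A B ∧
      ((μ.assigned h \ B) ∪ A).card ≤ M.κ h ∧
      P.hpref h ((μ.assigned h \ B) ∪ A) (μ.assigned h)

/-- The pair `(h, s)` (hospital or dummy, single doctor) blocks `μ`. -/
def BlocksSingle (M : Market D H) (P : Profile D H) (μ : Matching M)
    (h : Option H) (s : D) : Prop :=
  P.dpref s h (μ.assign s) ∧ HosPrefers M P μ h {s}

/-- The pair `((h_f, h_m), c)` (pair of hospitals or dummies, couple `c = (f, m)`)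
blocks `μ`. -/
def BlocksCouple (M : Market D H) (P : Profile D H) (μ : Matching M)
    (hf hm : Option H) (c : D × D) : Prop :=
  P.cpref c (hf, hm) (μ.assign c.1, μ.assign c.2) ∧
  (hf ≠ hm → μ.assign c.1 ≠ hf → HosPrefers M P μ hf {c.1}) ∧
  (hf ≠ hm → μ.assign c.2 ≠ hm → HosPrefers M P μ hm {c.2}) ∧
  (hf = hm → HosPrefers M P μ hf {c.1, c.2})

/-- Stability: no single blocking pair, no couple blocking pair, and no
hospital prefers `∅` to its assignment. -/
def Stable (M : Market D H) (P : Profile D H) (μ : Matching M) : Prop :=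
  (∀ (h : Option H) (s : D), M.Single s → ¬ BlocksSingle M P μ h s) ∧
  (∀ (hf hm : Option H), ∀ c ∈ M.couples, ¬ BlocksCouple M P μ hf hm c) ∧
  (∀ h : H, ¬ HosPrefers M P μ (some h) ∅)

/-- Individual rationality. -/
def IndivRational (M : Market D H) (P : Profile D H) (μ : Matching M) : Prop :=
  (∀ s : D, M.Single s → weakPref (P.dpref s) (μ.assign s) none) ∧
  (∀ c ∈ M.couples, weakPref (P.cpref c) (μ.assign c.1, μ.assign c.2) (none, none)) ∧
  (∀ h : H, ∀ d ∈ μ.assigned h, d ∈ P.acc h)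

/-- Extreme-altruism of the profile of couple preferences: for every couple
`c = (f, m)`, every hospital `h` with `κ_h ≤ |D| - 2` and all
`h', h'' ∈ H ∪ {λ}`:  (i) `h' P_f h`, `h' R_f h''` and `h'' R_m λ` imply
`(h', h'') P_c (h, h)`; and (ii) symmetrically for `m`. -/
def ExtremeAltruism (M : Market D H) (P : Profile D H) : Prop :=
  ∀ c ∈ M.couples, ∀ h : H, M.κ h ≤ Fintype.card D - 2 →
    ∀ h' h'' : Option H,
      ((P.dpref c.1 h' (some h) ∧ weakPref (P.dpref c.1) h' h'' ∧
          weakPref (P.dpref c.2) h'' none) →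
        P.cpref c (h', h'') (some h, some h)) ∧
      ((P.dpref c.2 h' (some h) ∧ weakPref (P.dpref c.2) h' h'' ∧
          weakPref (P.dpref c.1) h'' none) →
        P.cpref c (h'', h') (some h, some h))

/-- Aversion to couple diversity of the profile of hospital preferences: for
every hospital `h`, every couple `c = (f, m)` of acceptable doctors and all
doctors `d₁, d₂` ranked strictly in between `f` and `m` by `h`, if more than
`κ_h` doctors are ranked above the worse member of the couple then
`{d₁, d₂} P_h {f, m}`. -/
def AversionToCoupleDiversity (M : Market D H) (P : Profile D H) : Prop :=
  ∀ h : H, ∀ c ∈ M.couples, c.1 ∈ P.acc h → c.2 ∈ P.acc h → ∀ d₁ d₂ : D,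
    ((P.rank h c.1 d₁ ∧ P.rank h d₁ d₂ ∧ P.rank h d₂ c.2 ∧
        M.κ h < {d : D | P.rank h d c.2}.ncard) ∨
     (P.rank h c.2 d₁ ∧ P.rank h d₁ d₂ ∧ P.rank h d₂ c.1 ∧
        M.κ h < {d : D | P.rank h d c.1}.ncard)) →
    P.hpref h {d₁, d₂} {c.1, c.2}

/-- `P` is an extension of the profile `P₀` of couple preferences: the couple
preferences (and hence their induced marginals) agree with `P₀`. -/
def CoupleExtension (M : Market D H) (P₀ P : Profile D H) : Prop :=
  ∀ c ∈ M.couples, P.cpref c = P₀.cpref c ∧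
    P.dpref c.1 = P₀.dpref c.1 ∧ P.dpref c.2 = P₀.dpref c.2

/-- `P` is an extension of the profile `P₀` of hospital preferences: the
hospital preferences (including the sets of acceptable doctors) agree with `P₀`. -/
def HospitalExtension (P₀ P : Profile D H) : Prop :=
  ∀ h : H, P.acc h = P₀.acc h ∧ P.rank h = P₀.rank h ∧ P.hpref h = P₀.hpref h

end CouplesMarket

namespace CouplesMarket

/- Example of Section 5: hospitals `h₁ = 0, h₂ = 1 : Fin 2`, each of capacity 2;
doctors `f = 0, m = 1, s₁ = 2, s₂ = 3 : Fin 4` with the unique couple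
`c = (f, m) = (0, 1)`. -/
def exampleMarket3 : Market (Fin 4) (Fin 2) where
  κ := fun _ => 2
  couples := {((0 : Fin 4), (1 : Fin 4))}
  couples_ne := by decide
  couples_disjoint := by decide

/-- The matching with `μ(h₁) = {f, s₁}` and `μ(h₂) = {s₂, m}`. -/
def exampleMatching3 : Matching exampleMarket3 where
  assign := fun d => if d = 0 ∨ d = 2 then some 0 else some 1
  quota := by decide

/-- If `h` has capacity two and accepts everybody, its two highest ranked doctors form its
favourite feasible set. -/
theorem HospResponsive.top_pair_pref {D H : Type} [Fintype D] [DecidableEq D] {M : Market D H}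
    {P : Profile D H} {h : H}
    (hP : HospResponsive M P h) (hacc : P.acc h = Finset.univ) (hκ : M.κ h = 2) {a b : D}
    (ha : ∀ x, x ≠ a → P.rank h a x) (hb : ∀ x, x ≠ a → x ≠ b → P.rank h b x) (hab : a ≠ b)
    {A : Finset D} (hA : A.card ≤ 2) : A = {a, b} ∨ P.hpref h {a, b} A := by
  obtain ⟨-, ⟨-, -, htrans, -⟩, hne, hsing, hins, -⟩ := hP
  simp only [hacc, hκ, Finset.subset_univ, Finset.mem_univ, forall_const, Set.mem_ofPred_eq]
    at htrans hne hsing hins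
  have pair_card (x y : D) : ({x, y} : Finset D).card ≤ 2 := Finset.card_le_two
  have sing_pref {x : D} (hx : x ≠ a) : P.hpref h {a} {x} :=
    (hsing a x hx.symm).2 (ha x hx)
  have swap_snd {y : D} (hya : y ≠ a) (hyb : y ≠ b) : P.hpref h {a, b} {a, y} :=
    (hins {b} {y} (by simp) (by simp) a (by simpa using hab) (by simpa using hya.symm)).2
      ((hsing b y hyb.symm).2 (hb y hya hyb))
  have swap_fst {x y : D} (hxa : x ≠ a) (hya : y ≠ a) (hxy : x ≠ y) :
      P.hpref h {a, y} {x, y} := by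
    rw [Finset.pair_comm a, Finset.pair_comm x]
    exact (hins {a} {x} (by simp) (by simp) y (by simpa using hya) (by simpa using hxy.symm)).2
      (sing_pref hxa)
  have drop_snd : P.hpref h {a, b} {a} := by
    simpa using (hins {b} ∅ (by simp) (by simp) a (by simpa using hab) (by simp)).2
      (hne {b} (by simp) (by simp))
  have avoid {x y : D} (hxa : x ≠ a) (hya : y ≠ a) (hxy : x ≠ y) (hyb : y ≠ b) :
      P.hpref h {a, b} {x, y} :=
    htrans _ (pair_card a b) _ (pair_card a y) _ (pair_card x y)
      (swap_snd hya hyb) (swap_fst hxa hya hxy)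
  obtain hc | hc | hc : A.card = 0 ∨ A.card = 1 ∨ A.card = 2 := by omega
  · rw [Finset.card_eq_zero] at hc
    subst hc
    exact .inr (hne _ (by simp) (pair_card a b))
  · obtain ⟨x, rfl⟩ := Finset.card_eq_one.1 hc
    by_cases hx : x = a
    · exact .inr (hx ▸ drop_snd)
    · exact .inr (htrans _ (pair_card a b) {a} (by simp) _ (by simp) drop_snd (sing_pref hx))
  · obtain ⟨x, y, hxy, rfl⟩ := Finset.card_eq_two.1 hc
    have of_left {y : D} (hy : y ≠ a) : ({a, y} : Finset D) = {a, b} ∨ P.hpref h {a, b} {a, y} := by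
      by_cases hyb : y = b
      · exact .inl (hyb ▸ rfl)
      · exact .inr (swap_snd hy hyb)
    by_cases hxa : x = a
    · subst hxa
      exact of_left hxy.symm
    by_cases hya : y = a
    · subst hya
      rw [Finset.pair_comm x]
      exact of_left hxy
    by_cases hyb : y = b
    · rw [Finset.pair_comm x]
      exact .inr (avoid hya hxa hxy.symm fun hxb => hxy (hxb.trans hyb.symm))
    · exact .inr (avoid hxa hya hxy hyb)

/-- A hospital matched with its two highest ranked doctors prefers no other set of doctors. -/
theorem HospResponsive.not_hosPrefers {D H : Type} [Fintype D] [DecidableEq D] [DecidableEq H]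
    {M : Market D H} {P : Profile D H} {h : H}
    (hP : HospResponsive M P h) (hacc : P.acc h = Finset.univ) (hκ : M.κ h = 2) {a b : D}
    (ha : ∀ x, x ≠ a → P.rank h a x) (hb : ∀ x, x ≠ a → x ≠ b → P.rank h b x) (hab : a ≠ b)
    {μ : Matching M} (hμ : μ.assigned h = {a, b}) (A : Finset D) :
    ¬ HosPrefers M P μ (some h) A := by
  rintro ⟨B, -, -, hcard, hpref⟩
  have hfeas : (μ.assigned h).card ≤ M.κ h := μ.quota h
  have htop := hP.top_pair_pref hacc hκ ha hb hab (hκ ▸ hcard)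
  obtain ⟨-, ⟨-, hirr, -, hasymm⟩, -⟩ := hP
  rw [← hμ] at htop
  obtain heq | htop := htop
  · rw [heq] at hpref
    exact hirr _ hfeas hpref
  · exact hasymm _ hcard _ hfeas hpref htop

/-- **Example**: even though `{f, m} P_{h₁} {s₁, s₂}` violates aversion to
couple diversity, if every doctor prefers any hospital to unemployment then
the matching `μ(h₁) = {f, s₁}`, `μ(h₂) = {s₂, m}` is stable. -/
theorem example3_stable_matching
    (P : Profile (Fin 4) (Fin 2))
    (hresp : Responsive exampleMarket3 P)
    (hacc : ∀ h : Fin 2, P.acc h = Finset.univ)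
    -- `P̄_{h₁} : f, s₁, s₂, m`
    (hr1 : P.rank 0 0 2 ∧ P.rank 0 2 3 ∧ P.rank 0 3 1)
    -- `P̄_{h₂} : s₂, m, f, s₁`
    (hr2 : P.rank 1 3 1 ∧ P.rank 1 1 0 ∧ P.rank 1 0 2)
    -- `{f, m} P_{h₁} {s₁, s₂}` (violating aversion to couple diversity)
    (hviol : P.hpref 0 {0, 1} {2, 3})
    -- every doctor prefers being matched with any hospital to `λ`
    (hnol : ∀ (d : Fin 4) (h : Fin 2), P.dpref d (some h) none) :
    Stable exampleMarket3 P exampleMatching3 := by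
  have rank_trans (h : Fin 2) {x y z : Fin 4} (hxy : P.rank h x y) (hyz : P.rank h y z) :
      P.rank h x z := by
    obtain ⟨⟨-, -, htrans, -⟩, -⟩ := hresp.1 h
    simp only [hacc, Finset.mem_univ, Set.mem_ofPred_eq, forall_const] at htrans
    exact htrans _ _ _ hxy hyz
  have no_hosp (h : Fin 2) (A : Finset (Fin 4)) :
      ¬ HosPrefers exampleMarket3 P exampleMatching3 (some h) A := by
    fin_cases h
    · obtain ⟨h02, h23, h31⟩ := hr1
      refine (hresp.1 0).not_hosPrefers (hacc 0) rfl (a := 0) (b := 2) ?_ ?_ (by decide)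
        (by decide) A
      · have h03 := rank_trans 0 h02 h23
        have h01 := rank_trans 0 h03 h31
        intro x hx
        fin_cases x <;> first | assumption | exact absurd rfl hx
      · have h21 := rank_trans 0 h23 h31
        intro x hx hx'
        fin_cases x <;> first | assumption | exact absurd rfl hx | exact absurd rfl hx'
    · obtain ⟨h31, h10, h02⟩ := hr2
      refine (hresp.1 1).not_hosPrefers (hacc 1) rfl (a := 3) (b := 1) ?_ ?_ (by decide)
        (by decide) A
      · have h30 := rank_trans 1 h31 h10
        have h32 := rank_trans 1 h30 h02
        intro x hx
        fin_cases x <;> first | assumption | exact absurd rfl hx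
      · have h12 := rank_trans 1 h10 h02
        intro x hx hx'
        fin_cases x <;> first | assumption | exact absurd rfl hx | exact absurd rfl hx'
  refine ⟨?_, ?_, fun h => no_hosp h ∅⟩
  · rintro (_ | h) s hs ⟨hpref, hhosp⟩
    · obtain ⟨-, -, -, hasymm⟩ := hresp.2.2 s hs
      obtain ⟨h, hh⟩ : ∃ h, exampleMatching3.assign s = some h :=
        (by decide : ∀ d, ∃ h, exampleMatching3.assign d = some h) s
      rw [hh] at hpref
      exact hasymm _ trivial _ trivial hpref (hnol s h)
    · exact no_hosp h _ hhosp
  · intro hf hm c hc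
    obtain ⟨⟨-, hirr, htrans, hasymm⟩, -, -, hmarg⟩ := hresp.2.1 c hc
    obtain rfl : c = (0, 1) := Finset.mem_singleton.1 hc
    rintro ⟨hpref, hblock_f, hblock_m, hblock⟩
    change P.cpref (0, 1) (hf, hm) (some 0, some 1) at hpref
    change hf ≠ hm → some 0 ≠ hf → _ at hblock_f
    change hf ≠ hm → some 1 ≠ hm → _ at hblock_m
    have lose_f (h : Option (Fin 2)) : P.cpref (0, 1) (some 0, h) (none, h) :=
      (hmarg h (some 0) none).1.2 (hnol 0 0)
    have lose_m (h : Option (Fin 2)) : P.cpref (0, 1) (h, some 1) (h, none) :=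
      (hmarg h (some 1) none).2.2 (hnol 1 1)
    have hf_eq : hf = some 0 ∨ hf = none := by
      obtain _ | h := hf
      · exact .inr rfl
      · by_contra hne
        by_cases heq : some h = hm
        · exact no_hosp h _ (hblock heq)
        · exact no_hosp h _ (hblock_f heq fun h0 => hne (.inl h0.symm))
    have hm_eq : hm = some 1 ∨ hm = none := by
      obtain _ | h := hm
      · exact .inr rfl
      · by_contra hne
        by_cases heq : hf = some h
        · subst heq
          exact no_hosp h _ (hblock rfl)
        · exact no_hosp h _ (hblock_m heq fun h1 => hne (.inl h1.symm))
    obtain rfl | rfl := hf_eq <;> obtain rfl | rfl := hm_eq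
    · exact hirr _ trivial hpref
    · exact hasymm _ trivial _ trivial hpref (lose_m _)
    · exact hasymm _ trivial _ trivial hpref (lose_f _)
    · exact hasymm _ trivial _ trivial hpref
        (htrans _ trivial _ trivial _ trivial (lose_m _) (lose_f _))

end CouplesMarket
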